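/- arXiv:quant-ph/0304131 — 4 statements merged into one kernel-verified Lean document; each statement's English description precedes it below -/
import Mathlib

section
/- Let n ≥ 1, N = 2^n, and let K be a natural number with 1 ≤ K ≤ N/2. Suppose L : ℕ → ℕ satisfies L(0) = N and, for every i, L(i+1) ≥ max(L(i) − K, ⌈L(i)/2⌉). Then L(m₀) ≥ 2, where m₀ = ⌊N/K⌋ + ⌊log₂ K⌋ − 3 (natural-number subtraction; ⌊log₂ K⌋ is the floor of the base-2 logarithm of K). -/
theorem le_add_mul_of_sub_le_succ {L : ℕ → ℕ} {K : ℕ} (h : ∀ i, L i - K ≤ L (i + 1)) (i : ℕ) :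
    L 0 ≤ L i + i * K := by
  induction i with
  | zero => simp
  | succ i ih =>
    have := h i
    rw [add_mul, one_mul]
    omega

theorem le_two_pow_mul_of_half_le_succ {L : ℕ → ℕ} (h : ∀ i, (L i + 1) / 2 ≤ L (i + 1))
    (a j : ℕ) : L a ≤ 2 ^ j * L (a + j) := by
  induction j with
  | zero => simp
  | succ j ih =>
    have hj : L (a + j) ≤ 2 * L (a + (j + 1)) := by
      have := h (a + j)
      rw [← add_assoc]
      omega
    calc L a ≤ 2 ^ j * L (a + j) := ih
      _ ≤ 2 ^ j * (2 * L (a + (j + 1))) := Nat.mul_le_mul_left _ hj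
      _ = 2 ^ (j + 1) * L (a + (j + 1)) := by ring

/-- Quantitative core (Claim 1) of the classical adversary argument: if `L 0 = N = 2^n`
and at every round `L` decreases additively by at most `K` and multiplicatively by at most
one half (`L (i+1) ≥ max (L i - K) ⌈L i / 2⌉`), then after
`m₀ = ⌊N/K⌋ + ⌊log₂ K⌋ - 3` rounds at least two candidates survive. -/
theorem adversary_survivors (n N K : ℕ) (hn : 1 ≤ n) (hN : N = 2 ^ n)
    (hK1 : 1 ≤ K) (hK2 : K ≤ N / 2) (L : ℕ → ℕ) (hL0 : L 0 = N)
    (hstep : ∀ i : ℕ, max (L i - K) ((L i + 1) / 2) ≤ L (i + 1)) :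
    2 ≤ L (N / K + Nat.log 2 K - 3) := by
  have hsub := le_add_mul_of_sub_le_succ fun i => (le_max_left _ _).trans (hstep i)
  have hhalf := le_two_pow_mul_of_half_le_succ fun i => (le_max_right _ _).trans (hstep i)
  obtain rfl | hK : K = 1 ∨ 2 ≤ K := by omega
  · have := hsub (N - 3)
    simp only [Nat.div_one, Nat.log_one_right, add_zero]
    omega
  · have hq : 2 ≤ N / K := (Nat.le_div_iff_mul_le hK1).2 (by omega)
    obtain ⟨q, hq⟩ := Nat.exists_eq_add_of_le' hq
    obtain ⟨j, hj⟩ := Nat.exists_eq_add_of_le' (Nat.log_pos one_lt_two hK)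
    have hm : N / K + Nat.log 2 K - 3 = q + j := by omega
    have hpow : 2 ^ (j + 1) ≤ K := by
      simpa [hj] using Nat.pow_log_le_self 2 (Nat.ne_of_gt hK1)
    have hqN : (q + 2) * K ≤ N := hq ▸ Nat.div_mul_le_self N K
    have hLq : 2 * K ≤ L q := by
      have := hsub q
      rw [add_mul] at hqN
      omega
    rw [hm]
    refine Nat.le_of_mul_le_mul_left (c := 2 ^ j) ?_ (by positivity)
    calc 2 ^ j * 2 = 2 ^ (j + 1) := (pow_succ 2 j).symm
      _ ≤ L q := by omega
      _ ≤ 2 ^ j * L (q + j) := hhalf q j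
end

section
/- Let n ≥ 1, N = 2^n, let f : Fin N → Fin N → Bool be an oracle such that for every column x the number of a with f(a,x) = true is at most K, where 1 ≤ K ≤ N/2, and let m < ⌊N/K⌋ + ⌊log₂ K⌋ − 2. Then for every deterministic adaptive m-query algorithm (q, out) there exist two distinct targets a₁ ≠ a₂ with identical transcripts, T_f(a₁) = T_f(a₂); consequently no deterministic adaptive algorithm making fewer than ⌊N/K⌋ + ⌊log₂ K⌋ − 2 queries can output the hidden target a correctly for every a. -/
/-- Transcript of a deterministic adaptive algorithm with query maps `q` run against the
row `x ↦ f a x` of the oracle `f` for the hidden target `a`: the `(i+1)`-st answer bit is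
`f a (q i (previous i answer bits))`. -/
def transcript {α : Type*} (f : α → α → Bool) (q : (i : ℕ) → (Fin i → Bool) → α)
    (a : α) : ℕ → Bool
  | i => f a (q i (fun j => transcript f q a j.val))
  termination_by i => i
  decreasing_by exact j.isLt

/-- The targets in `S` have transcripts agreeing on the first `i` answers. -/
def AgreeUpTo {α : Type*} (f : α → α → Bool) (q : (i : ℕ) → (Fin i → Bool) → α)
    (i : ℕ) (S : Finset α) : Prop :=
  ∀ a ∈ S, ∀ b ∈ S, ∀ j < i, transcript f q a j = transcript f q b j

theorem AgreeUpTo.filter_succ {α : Type*} {f : α → α → Bool}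
    {q : (i : ℕ) → (Fin i → Bool) → α} {i : ℕ} {S : Finset α}
    (h : AgreeUpTo f q i S) (c : Bool) :
    AgreeUpTo f q (i + 1) (S.filter fun a => transcript f q a i = c) := by
  intro a ha b hb j hj
  rw [Finset.mem_filter] at ha hb
  rcases Nat.lt_succ_iff_lt_or_eq.mp hj with hj | rfl
  · exact h a ha.1 b hb.1 j hj
  · rw [ha.2, hb.2]

/-- Targets agreeing so far are all asked the same next query. -/
theorem AgreeUpTo.exists_query {α : Type*} [Inhabited α] {f : α → α → Bool}
    {q : (i : ℕ) → (Fin i → Bool) → α} {i : ℕ} {S : Finset α}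
    (h : AgreeUpTo f q i S) :
    ∃ x, ∀ a ∈ S, transcript f q a i = f a x := by
  rcases S.eq_empty_or_nonempty with rfl | ⟨b, hb⟩
  · exact ⟨default, by simp⟩
  · refine ⟨q i fun j => transcript f q b j, fun a ha => ?_⟩
    rw [transcript]
    congr 2
    funext j
    exact h a ha b hb j j.isLt

theorem card_filter_true_add_card_filter_false {α : Type*} (S : Finset α) (g : α → Bool) :
    (S.filter fun a => g a = true).card + (S.filter fun a => g a = false).card = S.card := by
  simpa using S.card_filter_add_card_filter_not (fun a => g a = true)

/-- Following the all-`false` branch discards at most `K` targets per query. -/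
theorem exists_agreeUpTo_card_add_mul {α : Type*} [Fintype α] [Inhabited α]
    (f : α → α → Bool) (q : (i : ℕ) → (Fin i → Bool) → α) {K : ℕ}
    (hcol : ∀ x, (Finset.univ.filter fun a => f a x = true).card ≤ K) (i : ℕ) :
    ∃ S, AgreeUpTo f q i S ∧ Fintype.card α ≤ S.card + i * K := by
  induction i with
  | zero => exact ⟨Finset.univ, fun _ _ _ _ _ hj => absurd hj (Nat.not_lt_zero _), by simp⟩
  | succ i ih =>
    obtain ⟨S, hS, hcard⟩ := ih
    refine ⟨_, hS.filter_succ false, ?_⟩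
    obtain ⟨x, hx⟩ := hS.exists_query
    have hsplit := card_filter_true_add_card_filter_false S fun a => transcript f q a i
    have hones : (S.filter fun a => transcript f q a i = true).card ≤ K := by
      refine (Finset.card_le_card fun a ha => ?_).trans (hcol x)
      rw [Finset.mem_filter] at ha
      simpa [← hx a ha.1] using ha.2
    rw [Nat.succ_mul]
    omega

/-- Following the majority branch discards at most half of the targets per query. -/
theorem AgreeUpTo.exists_card_le_two_pow_mul {α : Type*} {f : α → α → Bool}
    {q : (i : ℕ) → (Fin i → Bool) → α} {i : ℕ} {S : Finset α}
    (h : AgreeUpTo f q i S) (t : ℕ) :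
    ∃ S', AgreeUpTo f q (i + t) S' ∧ S.card ≤ 2 ^ t * S'.card := by
  induction t with
  | zero => exact ⟨S, h, by simp⟩
  | succ t ih =>
    obtain ⟨S', hS', hcard⟩ := ih
    have hsplit := card_filter_true_add_card_filter_false S' fun a => transcript f q a (i + t)
    have hmajority : ∃ c : Bool,
        S'.card ≤ 2 * (S'.filter fun a => transcript f q a (i + t) = c).card := by
      by_contra! hsmall
      have htrue := hsmall true
      have hfalse := hsmall false
      omega
    obtain ⟨c, hc⟩ := hmajority
    refine ⟨_, hS'.filter_succ c, hcard.trans ?_⟩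
    rw [pow_succ, mul_assoc]
    exact Nat.mul_le_mul_left _ hc

/-- Classical lower bound: if every column of the oracle's truth table contains at most
`K` ones and `m < ⌊N/K⌋ + ⌊log₂ K⌋ - 2`, then any deterministic adaptive `m`-query
algorithm has two distinct targets with identical transcripts, hence cannot be correct
for every hidden target. -/
theorem classical_lower_bound (n N K m : ℕ) (hn : 1 ≤ n) (hN : N = 2 ^ n)
    (hK1 : 1 ≤ K) (hK2 : K ≤ N / 2)
    (f : Fin N → Fin N → Bool)
    (hcol : ∀ x : Fin N, (Finset.univ.filter (fun a : Fin N => f a x = true)).card ≤ K)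
    (hm : m < N / K + Nat.log 2 K - 2)
    (q : (i : ℕ) → (Fin i → Bool) → Fin N)
    (out : (Fin m → Bool) → Fin N) :
    (∃ a₁ a₂ : Fin N, a₁ ≠ a₂ ∧
      (fun i : Fin m => transcript f q a₁ i) = (fun i : Fin m => transcript f q a₂ i)) ∧
    ¬ (∀ a : Fin N, out (fun i : Fin m => transcript f q a i) = a) := by
  have hK : 2 ≤ N / K := by
    rw [Nat.le_div_iff_mul_le hK1]
    omega
  have : Inhabited (Fin N) := ⟨⟨0, by rw [hN]; positivity⟩⟩
  have hcollision : ∃ a₁ a₂ : Fin N, a₁ ≠ a₂ ∧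
      (fun i : Fin m => transcript f q a₁ i) = (fun i : Fin m => transcript f q a₂ i) := by
    obtain ⟨S, hS, hScard⟩ := exists_agreeUpTo_card_add_mul f q hcol (N / K - 2)
    obtain ⟨S', hS', hcard⟩ := hS.exists_card_le_two_pow_mul (Nat.log 2 K)
    have htwoK : 2 * K ≤ S.card := by
      have hdiv := Nat.div_mul_le_self N K
      rw [Fintype.card_fin, Nat.sub_mul] at hScard
      have := Nat.mul_le_mul_right K hK
      omega
    have hlog : 2 ^ Nat.log 2 K ≤ K := Nat.pow_log_le_self 2 (by omega)
    have hone : 1 < S'.card := by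
      by_contra! hle
      have := Nat.mul_le_mul_left (2 ^ Nat.log 2 K) hle
      omega
    obtain ⟨a₁, ha₁, a₂, ha₂, hne⟩ := Finset.one_lt_card.mp hone
    exact ⟨a₁, a₂, hne, funext fun i => hS' a₁ ha₁ a₂ ha₂ i (by omega)⟩
  refine ⟨hcollision, fun hcorrect => ?_⟩
  obtain ⟨a₁, a₂, hne, heq⟩ := hcollision
  exact hne (by rw [← hcorrect a₁, heq, hcorrect a₂])
end

section
/- Let 1 ≤ k ≤ n and let h_k be the hybrid oracle on {0,1}^n. There exists a deterministic adaptive algorithm making at most 2^{n−k} + k queries to x ↦ h_k(a,x) that outputs the hidden target a correctly for every a ∈ {0,1}^n: it first determines the first n−k bits of a by exhaustively querying all strings with all-zero suffix, and then determines the last k bits with k further queries. -/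
/-- The hybrid oracle `h_k` on `{0,1}^n`: `h_k(a,x) = 1` iff the first `n-k` bits of
`a` and `x` agree and the inner product of the last `k` bits is `0` mod `2`. -/
def hyb (n k : ℕ) (a x : Fin n → Bool) : Bool :=
  decide ((∀ i : Fin n, (i : ℕ) < n - k → a i = x i) ∧
    (Finset.univ.filter (fun i : Fin n => n - k ≤ (i : ℕ) ∧ a i = true ∧ x i = true)).card % 2 = 0)

/-- The vector agreeing with `a` on the coordinates below `m` and zero elsewhere. -/
def zeroSuffix {n : ℕ} (m : ℕ) (a : Fin n → Bool) : Fin n → Bool :=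
  fun i => if (i : ℕ) < m then a i else false

lemma hyb_zeroSuffix_eq_true_iff (n k : ℕ) (a v : Fin n → Bool) :
    hyb n k a (zeroSuffix (n - k) v) = true ↔ zeroSuffix (n - k) v = zeroSuffix (n - k) a := by
  have hcard : (Finset.univ.filter (fun i : Fin n =>
      n - k ≤ (i : ℕ) ∧ a i = true ∧ zeroSuffix (n - k) v i = true)) = ∅ := by
    refine Finset.filter_eq_empty_iff.mpr ?_
    rintro i - ⟨h, -, h'⟩
    simp [zeroSuffix, not_lt.mpr h] at h'
  simp only [hyb, hcard, Finset.card_empty, decide_eq_true_eq, Nat.zero_mod, and_true]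
  constructor
  · intro h
    funext i
    by_cases hi : (i : ℕ) < n - k
    · have := h i hi
      simp_all [zeroSuffix]
    · simp [zeroSuffix, hi]
  · intro h i hi
    have := congrFun h i
    simp_all [zeroSuffix]

lemma hyb_update_zeroSuffix (n k : ℕ) (a : Fin n → Bool) (x : Fin n) (hx : n - k ≤ (x : ℕ)) :
    hyb n k a (Function.update (zeroSuffix (n - k) a) x true) = !(a x) := by
  have hcard : (Finset.univ.filter (fun i : Fin n => n - k ≤ (i : ℕ) ∧ a i = true ∧
      Function.update (zeroSuffix (n - k) a) x true i = true)) = if a x = true then {x} else ∅ := by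
    ext i
    by_cases hi : i = x
    · subst hi
      cases h : a i <;> simp [h, Nat.sub_le_iff_le_add.mp hx]
    · have : ¬ (n - k ≤ (i : ℕ) ∧ a i = true ∧ zeroSuffix (n - k) a i = true) := by
        rintro ⟨h, -, h'⟩
        simp [zeroSuffix, not_lt.mpr h] at h'
      cases h : a x <;> simpa [hi, Function.update_of_ne] using this
  have hpre : ∀ i : Fin n, (i : ℕ) < n - k →
      a i = Function.update (zeroSuffix (n - k) a) x true i := by
    intro i hi
    have hne : i ≠ x := by rintro rfl; omega
    simp [Function.update_of_ne hne, zeroSuffix, hi]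
  rw [hyb, hcard]
  cases h : a x <;> simpa using hpre

/-- Every zero-suffix vector occurs in some list of length `2 ^ m` of vectors. -/
lemma exists_enum_zeroSuffix (n m : ℕ) (hm : m ≤ n) :
    ∃ e : Fin (2 ^ m) → (Fin n → Bool),
      ∀ a : Fin n → Bool, ∃ j, zeroSuffix m (e j) = zeroSuffix m a := by
  have hc : Fintype.card (Fin m → Bool) = 2 ^ m := by simp
  let φ := (Fintype.equivFinOfCardEq hc).symm
  refine ⟨fun j i => if h : (i : ℕ) < m then φ j ⟨i, h⟩ else false, fun a => ?_⟩
  refine ⟨φ.symm (fun i => a (Fin.castLE hm i)), ?_⟩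
  funext i
  by_cases hi : (i : ℕ) < m <;> simp [zeroSuffix, hi]

open Classical in
/-- The prefix read off from answers `t` to the exhaustive queries `zeroSuffix m (e j)`. -/
noncomputable def decodePrefix {n N l : ℕ} (m : ℕ) (e : Fin N → (Fin n → Bool))
    (t : Fin l → Bool) : Fin n → Bool :=
  if h : ∃ j : Fin N, ∃ hj : (j : ℕ) < l, t ⟨j, hj⟩ = true then zeroSuffix m (e h.choose)
  else fun _ => false

lemma decodePrefix_eq {n N l : ℕ} (m : ℕ) (e : Fin N → (Fin n → Bool)) (t : Fin l → Bool)
    (a : Fin n → Bool) (hl : N ≤ l) (he : ∃ j, zeroSuffix m (e j) = zeroSuffix m a)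
    (ht : ∀ j : Fin N, t ⟨j, j.isLt.trans_le hl⟩ = true ↔ zeroSuffix m (e j) = zeroSuffix m a) :
    decodePrefix m e t = zeroSuffix m a := by
  have h : ∃ j : Fin N, ∃ hj : (j : ℕ) < l, t ⟨j, hj⟩ = true := by
    obtain ⟨j, hj⟩ := he
    exact ⟨j, j.isLt.trans_le hl, (ht j).2 hj⟩
  rw [decodePrefix, dif_pos h]
  obtain ⟨_, h'⟩ := h.choose_spec
  exact (ht _).1 h'

/-- Classical upper bound for the hybrid oracle: there is a deterministic adaptive
algorithm making `2^(n-k) + k` queries to `x ↦ h_k(a,x)` that outputs the hidden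
target `a` correctly for every `a`. -/
theorem hyb_classical_upper_bound (n k : ℕ) (hk1 : 1 ≤ k) (hkn : k ≤ n) :
    ∃ (q : (i : ℕ) → (Fin i → Bool) → (Fin n → Bool))
      (out : (Fin (2 ^ (n - k) + k) → Bool) → (Fin n → Bool)),
      ∀ a : Fin n → Bool, out (fun i => transcript (hyb n k) q a i) = a := by
  obtain ⟨e, he⟩ := exists_enum_zeroSuffix n (n - k) (Nat.sub_le n k)
  let q : (i : ℕ) → (Fin i → Bool) → (Fin n → Bool) := fun i t =>
    if h : i < 2 ^ (n - k) then zeroSuffix (n - k) (e ⟨i, h⟩)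
    else if h' : n - k + (i - 2 ^ (n - k)) < n then
      Function.update (decodePrefix (n - k) e t) ⟨n - k + (i - 2 ^ (n - k)), h'⟩ true
    else fun _ => false
  refine ⟨q, fun t x => if h : (x : ℕ) < n - k then decodePrefix (n - k) e t x
    else !(t ⟨2 ^ (n - k) + (x - (n - k)), by omega⟩), fun a => ?_⟩
  have hsearch : ∀ j : Fin (2 ^ (n - k)), transcript (hyb n k) q a j = true ↔
      zeroSuffix (n - k) (e j) = zeroSuffix (n - k) a := by
    intro j
    rw [transcript, ← hyb_zeroSuffix_eq_true_iff]
    simp [q]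
  have hdecode : ∀ l, 2 ^ (n - k) ≤ l →
      decodePrefix (n - k) e (fun j : Fin l => transcript (hyb n k) q a j) =
        zeroSuffix (n - k) a :=
    fun l hl => decodePrefix_eq _ _ _ _ hl (he a) hsearch
  funext x
  by_cases hx : (x : ℕ) < n - k
  · simp only [hx, dif_pos]
    rw [hdecode _ (Nat.le_add_right _ _)]
    simp [zeroSuffix, hx]
  · have hidx : n - k + ((x : ℕ) - (n - k)) = x := by omega
    have hanswer : transcript (hyb n k) q a (2 ^ (n - k) + (x - (n - k))) = !(a x) := by
      rw [transcript, ← hyb_update_zeroSuffix n k a x (not_lt.mp hx)]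
      simp [q, hidx, hdecode]
    simp [hx, hanswer]
end

section
/- Let 1 ≤ k ≤ n, N = 2^n, K = 2^k, and let h_k be the hybrid oracle on {0,1}^n. Then every correct deterministic adaptive algorithm that recovers the hidden target a from queries to x ↦ h_k(a,x) for all a ∈ {0,1}^n must make at least N/K + k − 2 queries. Combined with the matching upper bound of 2^{n−k} + k queries, the deterministic classical query complexity of the hybrid oracle search problem is Θ(N/K + log K). -/
/-- The string with first `n - k` bits `p` and last `k` bits `s`. -/
def joinBits (n k : ℕ) (p : Fin (n - k) → Bool) (s : Fin k → Bool) : Fin n → Bool :=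
  fun i => if h : (i : ℕ) < n - k then p ⟨i, h⟩ else s ⟨i - (n - k), by omega⟩

/-- The first `n - k` bits of a string. -/
def prefixBits (n k : ℕ) (a : Fin n → Bool) : Fin (n - k) → Bool :=
  fun i => a ⟨i, by omega⟩

lemma prefixBits_joinBits {n k : ℕ} (p : Fin (n - k) → Bool) (s : Fin k → Bool) :
    prefixBits n k (joinBits n k p s) = p := by
  funext i
  simp [prefixBits, joinBits]

lemma joinBits_injective {n k : ℕ} (hkn : k ≤ n) (p : Fin (n - k) → Bool) :
    Function.Injective (joinBits n k p) := by
  intro s t h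
  funext j
  have := congrFun h ⟨n - k + j, by omega⟩
  simpa [joinBits] using this

lemma prefixBits_eq_iff {n k : ℕ} (a x : Fin n → Bool) :
    prefixBits n k a = prefixBits n k x ↔ ∀ i : Fin n, (i : ℕ) < n - k → a i = x i :=
  ⟨fun h i hi => congrFun h ⟨i, hi⟩, fun h => funext fun i => h ⟨i, by omega⟩ i.isLt⟩

lemma hyb_eq_false_of_prefixBits_ne {n k : ℕ} {a x : Fin n → Bool}
    (h : prefixBits n k a ≠ prefixBits n k x) : hyb n k a x = false := by
  rw [Ne, prefixBits_eq_iff] at h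
  simp only [hyb, decide_eq_false_iff_not]
  exact fun h' => h h'.1

lemma hyb_joinBits_zero {n k : ℕ} (a : Fin n → Bool) (p : Fin (n - k) → Bool) :
    hyb n k a (joinBits n k p fun _ => false) = decide (prefixBits n k a = p) := by
  have hcard : (Finset.univ.filter (fun i : Fin n => n - k ≤ (i : ℕ) ∧ a i = true ∧
      joinBits n k p (fun _ => false) i = true)) = ∅ := by
    refine Finset.filter_false_of_mem fun i _ h => ?_
    simp [joinBits, not_lt.mpr h.1] at h
  have hpre := prefixBits_eq_iff (k := k) a (joinBits n k p fun _ => false)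
  rw [prefixBits_joinBits] at hpre
  simp only [hyb, hcard, ← hpre]
  simp

lemma hyb_joinBits_single {n k : ℕ} (hkn : k ≤ n) (a : Fin n → Bool) (j : Fin k) :
    hyb n k a (joinBits n k (prefixBits n k a) fun l => decide (l = j)) =
      !a ⟨n - k + j, by omega⟩ := by
  have hcard : (Finset.univ.filter (fun i : Fin n => n - k ≤ (i : ℕ) ∧ a i = true ∧
      joinBits n k (prefixBits n k a) (fun l => decide (l = j)) i = true)) =
      if a ⟨n - k + j, by omega⟩ then {⟨n - k + j, by omega⟩} else ∅ := by
    have key : ∀ i : Fin n, (n - k ≤ (i : ℕ) ∧ a i = true ∧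
        joinBits n k (prefixBits n k a) (fun l => decide (l = j)) i = true) ↔
        (a i = true ∧ i = ⟨n - k + j, by omega⟩) := by
      intro i
      by_cases hi : (i : ℕ) < n - k
      · simp only [Fin.ext_iff]
        constructor <;> rintro ⟨h, h'⟩ <;> omega
      · simp only [joinBits, hi, dite_false, decide_eq_true_eq, Fin.ext_iff]
        constructor
        · rintro ⟨h, h', h''⟩
          exact ⟨h', by omega⟩
        · rintro ⟨h, h'⟩
          exact ⟨by omega, h, by omega⟩
    ext i
    rw [Finset.mem_filter, key]
    split_ifs with h
    · simp only [Finset.mem_univ, true_and, Finset.mem_singleton]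
      exact ⟨fun h' => h'.2, fun h' => ⟨h' ▸ h, h'⟩⟩
    · simp only [Finset.mem_univ, true_and, Finset.notMem_empty, iff_false]
      exact fun h' => h (h'.2 ▸ h'.1)
  have hpre := (prefixBits_eq_iff (k := k) a
    (joinBits n k (prefixBits n k a) fun l => decide (l = j))).mp (prefixBits_joinBits _ _).symm
  simp only [hyb, hcard]
  cases h : a ⟨n - k + j, by omega⟩
  · simpa using hpre
  · simp

lemma transcript_eq {α : Type*} (f : α → α → Bool) (q : (i : ℕ) → (Fin i → Bool) → α)
    (a : α) (i : ℕ) : transcript f q a i = f a (q i fun j => transcript f q a j) := by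
  rw [transcript]

/-- A target whose prefix is never queried along the all-`false` path is answered `false`. -/
lemma transcript_hyb_eq_false {n k r : ℕ} (q : (i : ℕ) → (Fin i → Bool) → (Fin n → Bool))
    (a : Fin n → Bool)
    (h : ∀ i < r, prefixBits n k a ≠ prefixBits n k (q i fun _ => false)) :
    ∀ i < r, transcript (hyb n k) q a i = false := by
  intro i
  induction i using Nat.strong_induction_on with
  | _ i ih =>
    intro hi
    rw [transcript_eq]
    have : (fun j : Fin i => transcript (hyb n k) q a j) = fun _ => false :=
      funext fun j => ih j j.isLt (j.isLt.trans hi)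
    rw [this]
    exact hyb_eq_false_of_prefixBits_ne (h i hi)

/-- If the algorithm is correct, at least `k` queries follow the first `2 ^ (n - k) - 1`. -/
lemma le_sub_of_correct {n k m : ℕ} (hkn : k ≤ n)
    (q : (i : ℕ) → (Fin i → Bool) → (Fin n → Bool))
    (out : (Fin m → Bool) → (Fin n → Bool))
    (hout : ∀ a : Fin n → Bool, out (fun i => transcript (hyb n k) q a i) = a) :
    k ≤ m - (2 ^ (n - k) - 1) := by
  set r := 2 ^ (n - k) - 1 with hr
  have hpos : 0 < 2 ^ (n - k) := by positivity
  obtain ⟨p, hp⟩ : ∃ p, p ∉ Set.range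
      fun i : Fin r => prefixBits n k (q i fun _ => false) := by
    by_contra! hall
    have := Fintype.card_le_of_surjective _ hall
    simp at this
    omega
  have hfalse (s : Fin k → Bool) : ∀ i < r,
      transcript (hyb n k) q (joinBits n k p s) i = false := by
    refine transcript_hyb_eq_false q _ fun i hi h => hp ⟨⟨i, hi⟩, ?_⟩
    rw [prefixBits_joinBits] at h
    exact h.symm
  have hinj : Function.Injective fun (s : Fin k → Bool) (j : Fin (m - r)) =>
      transcript (hyb n k) q (joinBits n k p s) (r + j) := by
    intro s t hst
    apply joinBits_injective hkn p
    rw [← hout (joinBits n k p s), ← hout (joinBits n k p t)]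
    congr 1
    funext i
    by_cases hi : (i : ℕ) < r
    · rw [hfalse s i hi, hfalse t i hi]
    · have := congrFun hst ⟨i - r, by omega⟩
      simpa [Nat.add_sub_cancel' (not_lt.mp hi)] using this
  have := Fintype.card_le_of_injective _ hinj
  simp only [Fintype.card_fun, Fintype.card_bool, Fintype.card_fin] at this
  exact (Nat.pow_le_pow_iff_right (by norm_num)).mp this

/-- A fixed enumeration of the binary strings of length `d`. -/
noncomputable def bitsEquiv (d : ℕ) : (Fin d → Bool) ≃ Fin (2 ^ d) :=
  Fintype.equivFinOfCardEq (by simp)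

/-- A string of length `d` whose entry in the answer list `t` is `true`. -/
noncomputable def foundPrefix (d : ℕ) {i : ℕ} (hi : 2 ^ d ≤ i) (t : Fin i → Bool) :
    Fin d → Bool :=
  Classical.epsilon fun p => t (Fin.castLE hi (bitsEquiv d p)) = true

/-- Query every prefix with zero suffix, then the unit suffixes under the prefix found. -/
noncomputable def prefixSearch (n k i : ℕ) (t : Fin i → Bool) : Fin n → Bool :=
  if h : i < 2 ^ (n - k) then
    joinBits n k ((bitsEquiv (n - k)).symm ⟨i, h⟩) fun _ => false
  else
    joinBits n k (foundPrefix (n - k) (not_lt.mp h) t)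
      fun l => decide ((l : ℕ) = i - 2 ^ (n - k))

lemma transcript_prefixSearch_prefix {n k : ℕ} (a : Fin n → Bool) (p : Fin (n - k) → Bool) :
    transcript (hyb n k) (prefixSearch n k) a (bitsEquiv (n - k) p) =
      decide (prefixBits n k a = p) := by
  rw [transcript_eq, prefixSearch, dif_pos (bitsEquiv (n - k) p).isLt, hyb_joinBits_zero]
  simp

lemma foundPrefix_transcript {n k i : ℕ} (hi : 2 ^ (n - k) ≤ i) (a : Fin n → Bool) :
    foundPrefix (n - k) hi (fun j => transcript (hyb n k) (prefixSearch n k) a j) =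
      prefixBits n k a := by
  have h : ∃ p, transcript (hyb n k) (prefixSearch n k) a (bitsEquiv (n - k) p) = true :=
    ⟨prefixBits n k a, by simp [transcript_prefixSearch_prefix]⟩
  have hspec := Classical.epsilon_spec h
  rw [transcript_prefixSearch_prefix, decide_eq_true_eq] at hspec
  exact hspec.symm

lemma transcript_prefixSearch_suffix {n k : ℕ} (hkn : k ≤ n) (a : Fin n → Bool) (j : Fin k) :
    transcript (hyb n k) (prefixSearch n k) a (2 ^ (n - k) + j) =
      !a ⟨n - k + j, by omega⟩ := by
  rw [transcript_eq, prefixSearch, dif_neg (by omega), foundPrefix_transcript,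
    ← hyb_joinBits_single hkn]
  simp [Fin.ext_iff]

/-- Tight classical query complexity `Θ(N/K + log K)` of the hybrid oracle search problem
(with `N = 2^n`, `K = 2^k`): every correct deterministic adaptive algorithm makes at
least `N/K + k - 2 = 2^(n-k) + k - 2` queries, and there is a correct one making
`2^(n-k) + k` queries. -/
theorem hyb_classical_complexity (n k : ℕ) (hk1 : 1 ≤ k) (hkn : k ≤ n) :
    (∀ (m : ℕ) (q : (i : ℕ) → (Fin i → Bool) → (Fin n → Bool))
        (out : (Fin m → Bool) → (Fin n → Bool)),
      (∀ a : Fin n → Bool, out (fun i => transcript (hyb n k) q a i) = a) →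
      2 ^ (n - k) + k - 2 ≤ m) ∧
    (∃ (q : (i : ℕ) → (Fin i → Bool) → (Fin n → Bool))
        (out : (Fin (2 ^ (n - k) + k) → Bool) → (Fin n → Bool)),
      ∀ a : Fin n → Bool, out (fun i => transcript (hyb n k) q a i) = a) := by
  refine ⟨fun m q out hout => ?_, prefixSearch n k, fun t => joinBits n k
    (foundPrefix (n - k) (Nat.le_add_right _ _) t) (fun j => !t (Fin.natAdd _ j)), fun a => ?_⟩
  · have := le_sub_of_correct hkn q out hout
    omega
  · funext i
    by_cases hi : (i : ℕ) < n - k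
    · simp [joinBits, hi, foundPrefix_transcript, prefixBits]
    · have := transcript_prefixSearch_suffix hkn a ⟨i - (n - k), by omega⟩
      simp [joinBits, hi, this, Nat.add_sub_cancel' (not_lt.mp hi)]
end
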